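/- Under hypotheses (H1)–(H4), with d = |K ∩ H⁺|^{1/n} − ((n/(n+1))ⁿ)^{1/n}, one has b' − b ≤ 288·n²·d^{1/(2n)}. -/

import Mathlib

open MeasureTheory Set
section Helpers

open scoped ENNReal Pointwise

theorem bm_one_dim_compact {A B C : Set ℝ} (hA : IsCompact A) (hB : IsCompact B)
    (hA0 : A.Nonempty) (hB0 : B.Nonempty) (h : ∀ x ∈ A, ∀ y ∈ B, x + y ∈ C) :
    volume A + volume B ≤ volume C := by
  obtain ⟨p, hpA, hp⟩ := hA.exists_isGreatest hA0
  obtain ⟨q, hqB, hq⟩ := hB.exists_isLeast hB0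
  have h1 : volume ((fun x => x + q) '' A) = volume A := by
    rw [Set.image_add_right]; exact measure_preimage_add_right volume (-q) A
  have h2 : volume ((fun x => p + x) '' B) = volume B := by
    rw [Set.image_add_left]; exact measure_preimage_add volume (-p) B
  have hmeas : MeasurableSet ((fun x => p + x) '' B) :=
    (hB.image (by fun_prop)).isClosed.measurableSet
  have hdisj : AEDisjoint volume ((fun x => x + q) '' A) ((fun x => p + x) '' B) := by
    refine measure_mono_null (t := {p + q}) ?_ (by simp)
    rintro _ ⟨⟨x, hx, rfl⟩, ⟨y, hy, hxy⟩⟩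
    have := hp hx
    have := hq hy
    simp only [mem_singleton_iff] at *
    linarith
  rw [← h1, ← h2, ← measure_union₀ hmeas.nullMeasurableSet hdisj]
  apply measure_mono
  rintro _ (⟨x, hx, rfl⟩ | ⟨y, hy, rfl⟩)
  · exact h x hx q hqB
  · exact h p hpA y hy

theorem bm_one_dim {A B C : Set ℝ} (hA : MeasurableSet A) (hB : MeasurableSet B)
    (hA0 : A.Nonempty) (hB0 : B.Nonempty) (h : ∀ x ∈ A, ∀ y ∈ B, x + y ∈ C) :
    volume A + volume B ≤ volume C := by
  obtain ⟨a, ha⟩ := hA0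
  obtain ⟨b, hb⟩ := hB0
  rw [hA.measure_eq_iSup_isCompact, hB.measure_eq_iSup_isCompact]
  simp only [iSup_and']
  refine ENNReal.biSup_add_biSup_le' (a := volume C) (p := fun K : Set ℝ => K ⊆ A ∧ IsCompact K)
    (q := fun K : Set ℝ => K ⊆ B ∧ IsCompact K) ⟨∅, by simp⟩ ⟨∅, by simp⟩ ?_
  rintro K ⟨hKA, hK⟩ L ⟨hLB, hL⟩
  calc volume K + volume L ≤ volume (insert a K) + volume (insert b L) :=
        add_le_add (measure_mono (subset_insert _ _)) (measure_mono (subset_insert _ _))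
    _ ≤ volume C := bm_one_dim_compact (hK.insert a) (hL.insert b) (insert_nonempty _ _)
        (insert_nonempty _ _) fun x hx y hy => h x (insert_subset ha hKA hx) y (insert_subset hb hLB hy)

theorem bm_one_dim_weighted {A B C : Set ℝ} (hA : MeasurableSet A) (hB : MeasurableSet B)
    (hA0 : A.Nonempty) (hB0 : B.Nonempty) {s t : ℝ} (hs : 0 < s) (ht : 0 < t)
    (h : ∀ x ∈ A, ∀ y ∈ B, s * x + t * y ∈ C) :
    ENNReal.ofReal s * volume A + ENNReal.ofReal t * volume B ≤ volume C := by
  have key := bm_one_dim (A := s • A) (B := t • B) (C := C) (hA.const_smul₀ s) (hB.const_smul₀ t)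
    hA0.smul_set hB0.smul_set (by
      rintro _ ⟨x, hx, rfl⟩ _ ⟨y, hy, rfl⟩
      exact h x hx y hy)
  rw [Measure.addHaar_smul, Measure.addHaar_smul] at key
  simpa [abs_of_pos hs, abs_of_pos ht] using key

theorem ennreal_layercake {f : ℝ → ℝ≥0∞} (hf : Measurable f) (hf1 : ∀ x, f x ≤ 1) :
    ∫⁻ x, f x = ∫⁻ r in Ioo (0:ℝ) 1, volume {x | ENNReal.ofReal r < f x} := by
  have h1 : ∫⁻ x, f x = ∫⁻ x, ENNReal.ofReal (f x).toReal := by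
    refine lintegral_congr fun x => ?_
    rw [ENNReal.ofReal_toReal (ne_top_of_le_ne_top ENNReal.one_ne_top (hf1 x))]
  rw [h1, lintegral_eq_lintegral_meas_lt volume (Filter.Eventually.of_forall fun x => by simp)
    hf.ennreal_toReal.aemeasurable]
  have h2 : ∀ r : ℝ, r ∈ Ioi (0:ℝ) → volume {x | r < (f x).toReal}
      = volume {x | ENNReal.ofReal r < f x} := by
    intro r hr
    congr 1
    ext x
    exact (ENNReal.ofReal_lt_iff_lt_toReal (le_of_lt hr)
      (ne_top_of_le_ne_top ENNReal.one_ne_top (hf1 x))).symm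
  rw [setLIntegral_congr_fun measurableSet_Ioi h2]
  symm
  have h3 : (Ioi (0:ℝ)) = Ioo 0 1 ∪ Ici 1 := by
    ext x; simp only [mem_Ioi, mem_union, mem_Ioo, mem_Ici]
    constructor
    · intro h; rcases lt_or_ge x 1 with h' | h'
      · exact Or.inl ⟨h, h'⟩
      · exact Or.inr h'
    · rintro (h | h)
      · exact h.1
      · linarith
  rw [h3, lintegral_union measurableSet_Ici]
  · rw [setLIntegral_eq_zero measurableSet_Ici]
    · simp
    · intro r hr
      have : {x | ENNReal.ofReal r < f x} = ∅ := by
        ext x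
        simp only [mem_ofPred_eq, mem_empty_iff_false, iff_false, not_lt]
        exact (hf1 x).trans (by simpa using hr)
      simp [this]
  · rw [Set.disjoint_left]; rintro x ⟨_, h⟩ h'; simp at h'; linarith

theorem pl_one_dim_normalised {s t : ℝ} (hs : 0 < s) (ht : 0 < t) (hst : s + t = 1)
    {f g h : ℝ → ℝ≥0∞} (hf : Measurable f) (hg : Measurable g) (hh : Measurable h)
    (hf1 : ⨆ x, f x = 1) (hg1 : ⨆ x, g x = 1)
    (H : ∀ x y, f x ^ s * g y ^ t ≤ h (s * x + t * y)) :
    ENNReal.ofReal s * (∫⁻ x, f x) + ENNReal.ofReal t * (∫⁻ x, g x) ≤ ∫⁻ x, h x := by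
  have hfle : ∀ x, f x ≤ 1 := fun x => hf1 ▸ le_iSup f x
  have hgle : ∀ x, g x ≤ 1 := fun x => hg1 ▸ le_iSup g x
  calc _ = ENNReal.ofReal s * (∫⁻ r in Ioo (0:ℝ) 1, volume {x | ENNReal.ofReal r < f x})
        + ENNReal.ofReal t * (∫⁻ r in Ioo (0:ℝ) 1, volume {x | ENNReal.ofReal r < g x}) := by
        rw [ennreal_layercake hf hfle, ennreal_layercake hg hgle]
    _ ≤ ∫⁻ r in Ioo (0:ℝ) 1, (ENNReal.ofReal s * volume {x | ENNReal.ofReal r < f x} +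
          ENNReal.ofReal t * volume {x | ENNReal.ofReal r < g x}) := by
        rw [← lintegral_const_mul' _ _ ENNReal.ofReal_ne_top,
          ← lintegral_const_mul' _ _ ENNReal.ofReal_ne_top]
        exact le_lintegral_add _ _
    _ ≤ ∫⁻ r in Ioo (0:ℝ) 1, volume {x | ENNReal.ofReal r < min (h x) 1} := by
        refine setLIntegral_mono' measurableSet_Ioo fun r hr => ?_
        have hr1 : ENNReal.ofReal r < 1 := by simpa using hr.2
        refine bm_one_dim_weighted (measurableSet_lt measurable_const hf)
          (measurableSet_lt measurable_const hg) ?_ ?_ hs ht ?_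
        · exact lt_iSup_iff.1 (hf1.symm ▸ hr1)
        · exact lt_iSup_iff.1 (hg1.symm ▸ hr1)
        · intro x hx y hy
          refine lt_min (lt_of_lt_of_le ?_ (H x y)) hr1
          have hx' : ENNReal.ofReal r < f x := hx
          have hy' : ENNReal.ofReal r < g y := hy
          have hr0 : ENNReal.ofReal r ≠ 0 := by simpa using hr.1
          calc ENNReal.ofReal r = ENNReal.ofReal r ^ s * ENNReal.ofReal r ^ t := by
                rw [← ENNReal.rpow_add _ _ hr0 ENNReal.ofReal_ne_top, hst, ENNReal.rpow_one]
            _ < f x ^ s * g y ^ t :=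
                ENNReal.mul_lt_mul (ENNReal.rpow_lt_rpow hx' hs) (ENNReal.rpow_lt_rpow hy' ht)
    _ = ∫⁻ x, min (h x) 1 := (ennreal_layercake (hh.min measurable_const)
          (fun x => min_le_right _ _)).symm
    _ ≤ ∫⁻ x, h x := lintegral_mono fun x => min_le_left _ _

theorem ennreal_amgm {s t : ℝ} (hs : 0 < s) (ht : 0 < t) (hst : s + t = 1) (a b : ℝ≥0∞) :
    a ^ s * b ^ t ≤ ENNReal.ofReal s * a + ENNReal.ofReal t * b := by
  by_cases ha : a = ∞
  · subst ha
    rw [ENNReal.mul_top (by simpa using hs)]; simp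
  by_cases hb : b = ∞
  · subst hb
    rw [ENNReal.mul_top (a := ENNReal.ofReal t) (by simpa using ht)]; simp
  lift a to NNReal using ha
  lift b to NNReal using hb
  lift s to NNReal using hs.le
  lift t to NNReal using ht.le
  rw [← ENNReal.coe_rpow_of_nonneg _ hs.le, ← ENNReal.coe_rpow_of_nonneg _ ht.le]
  have := NNReal.geom_mean_le_arith_mean2_weighted s t a b (by exact_mod_cast hst)
  simpa using (by exact_mod_cast this : ((a ^ (s:ℝ) * b ^ (t:ℝ) : NNReal) : ℝ≥0∞) ≤ ((s * a + t * b : NNReal) : ℝ≥0∞))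

theorem pl_one_dim_bdd {s t : ℝ} (hs : 0 < s) (ht : 0 < t) (hst : s + t = 1)
    {f g h : ℝ → ℝ≥0∞} (hf : Measurable f) (hg : Measurable g) (hh : Measurable h)
    (hf1 : ⨆ x, f x ≠ ∞) (hg1 : ⨆ x, g x ≠ ∞)
    (H : ∀ x y, f x ^ s * g y ^ t ≤ h (s * x + t * y)) :
    (∫⁻ x, f x) ^ s * (∫⁻ x, g x) ^ t ≤ ∫⁻ x, h x := by
  set α := ⨆ x, f x with hα
  set β := ⨆ x, g x with hβ
  by_cases hα0 : α = 0
  · have : ∀ x, f x = 0 := by simpa [hα] using hα0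
    simp [this, ENNReal.zero_rpow_of_pos hs]
  by_cases hβ0 : β = 0
  · have : ∀ x, g x = 0 := by simpa [hβ] using hβ0
    simp [this, ENNReal.zero_rpow_of_pos ht]
  have e1 : α⁻¹ ^ s * α ^ s = 1 := by
    rw [← ENNReal.mul_rpow_of_nonneg _ _ hs.le, ENNReal.inv_mul_cancel hα0 hf1, ENNReal.one_rpow]
  have e2 : β⁻¹ ^ t * β ^ t = 1 := by
    rw [← ENNReal.mul_rpow_of_nonneg _ _ ht.le, ENNReal.inv_mul_cancel hβ0 hg1, ENNReal.one_rpow]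
  set c := α⁻¹ ^ s * β⁻¹ ^ t with hc
  have hcc : (α ^ s * β ^ t) * c = 1 := by
    rw [hc]
    calc _ = (α⁻¹ ^ s * α ^ s) * (β⁻¹ ^ t * β ^ t) := by ring
      _ = 1 := by rw [e1, e2, one_mul]
  have key := pl_one_dim_normalised hs ht hst (f := fun x => α⁻¹ * f x) (g := fun x => β⁻¹ * g x)
    (h := fun x => c * h x) (hf.const_mul _) (hg.const_mul _) (hh.const_mul _)
    (by rw [← ENNReal.mul_iSup, ← hα, ENNReal.inv_mul_cancel hα0 hf1])
    (by rw [← ENNReal.mul_iSup, ← hβ, ENNReal.inv_mul_cancel hβ0 hg1])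
    (by
      intro x y
      rw [ENNReal.mul_rpow_of_nonneg _ _ hs.le, ENNReal.mul_rpow_of_nonneg _ _ ht.le]
      calc _ = c * (f x ^ s * g y ^ t) := by rw [hc]; ring
        _ ≤ _ := by gcongr; exact H x y)
  rw [lintegral_const_mul _ hf, lintegral_const_mul _ hg, lintegral_const_mul _ hh] at key
  have k2 := (ennreal_amgm hs ht hst _ _).trans key
  rw [ENNReal.mul_rpow_of_nonneg _ _ hs.le, ENNReal.mul_rpow_of_nonneg _ _ ht.le] at k2
  calc (∫⁻ x, f x) ^ s * (∫⁻ x, g x) ^ t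
      = (α ^ s * β ^ t) * c * ((∫⁻ x, f x) ^ s * (∫⁻ x, g x) ^ t) := by rw [hcc, one_mul]
    _ = (α ^ s * β ^ t) * (α⁻¹ ^ s * (∫⁻ x, f x) ^ s * (β⁻¹ ^ t * (∫⁻ x, g x) ^ t)) := by
        rw [hc]; ring
    _ ≤ (α ^ s * β ^ t) * (c * ∫⁻ x, h x) := by gcongr
    _ = ∫⁻ x, h x := by rw [← mul_assoc, hcc, one_mul]

theorem trunc_tendsto {f : ℝ → ℝ≥0∞} (hf : Measurable f) :
    Filter.Tendsto (fun N : ℕ => ∫⁻ x, min (f x) N) Filter.atTop (nhds (∫⁻ x, f x)) := by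
  refine lintegral_tendsto_of_tendsto_of_monotone
    (fun N => (hf.min measurable_const).aemeasurable) ?_ ?_
  · refine Filter.Eventually.of_forall fun x N M hNM => ?_
    exact min_le_min le_rfl (by exact_mod_cast hNM)
  · refine Filter.Eventually.of_forall fun x => ?_
    have : Filter.Tendsto (fun N : ℕ => min (f x) (N : ℝ≥0∞)) Filter.atTop (nhds (min (f x) ∞)) :=
      tendsto_const_nhds.min ENNReal.tendsto_nat_nhds_top
    simpa using this

/-- The Prekopa-Leindler inequality on a space `E`. -/
def PLProp (E : Type) [AddCommGroup E] [Module ℝ E] [MeasureSpace E] : Prop :=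
  ∀ s t : ℝ, 0 < s → 0 < t → s + t = 1 → ∀ f g h : E → ℝ≥0∞, Measurable f → Measurable g →
    Measurable h → (∀ x y, f x ^ s * g y ^ t ≤ h (s • x + t • y)) →
    (∫⁻ x, f x) ^ s * (∫⁻ x, g x) ^ t ≤ ∫⁻ x, h x

theorem pl_real : PLProp ℝ := by
  intro s t hs ht hst f g h hf hg hh H
  by_cases hf0 : ∫⁻ x, f x = 0
  · simp [hf0, ENNReal.zero_rpow_of_pos hs]
  by_cases hg0 : ∫⁻ x, g x = 0
  · simp [hg0, ENNReal.zero_rpow_of_pos ht]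
  have hlim : Filter.Tendsto (fun N : ℕ => (∫⁻ x, min (f x) N) ^ s * (∫⁻ x, min (g x) N) ^ t)
      Filter.atTop (nhds ((∫⁻ x, f x) ^ s * (∫⁻ x, g x) ^ t)) := by
    refine ENNReal.Tendsto.mul ((ENNReal.continuous_rpow_const.tendsto _).comp (trunc_tendsto hf))
      (Or.inl ?_) ((ENNReal.continuous_rpow_const.tendsto _).comp (trunc_tendsto hg)) (Or.inl ?_)
    · simp [ENNReal.rpow_eq_zero_iff, hf0, hs.le]
    · simp [ENNReal.rpow_eq_zero_iff, hg0, ht.le]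
  refine le_of_tendsto' hlim fun N => ?_
  refine pl_one_dim_bdd hs ht hst (hf.min measurable_const) (hg.min measurable_const) hh ?_ ?_ ?_
  · exact ne_top_of_le_ne_top (ENNReal.natCast_ne_top N) (iSup_le fun x => min_le_right _ _)
  · exact ne_top_of_le_ne_top (ENNReal.natCast_ne_top N) (iSup_le fun x => min_le_right _ _)
  · intro x y
    refine le_trans ?_ (H x y)
    gcongr
    · exact min_le_left _ _
    · exact min_le_left _ _

theorem pl_prod {E : Type} [AddCommGroup E] [Module ℝ E] [MeasureSpace E]
    [SFinite (volume : Measure E)] (hE : PLProp E) : PLProp (ℝ × E) := by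
  intro s t hs ht hst f g h hf hg hh H
  have e : ∀ {k : ℝ × E → ℝ≥0∞}, Measurable k → ∫⁻ p, k p = ∫⁻ x, ∫⁻ y, k (x, y) := fun hk =>
    lintegral_prod _ hk.aemeasurable
  rw [e hf, e hg, e hh]
  refine pl_real s t hs ht hst _ _ _ hf.lintegral_prod_right' hg.lintegral_prod_right'
    hh.lintegral_prod_right' fun x y => ?_
  refine hE s t hs ht hst _ _ _ (hf.comp measurable_prodMk_left) (hg.comp measurable_prodMk_left)
    (hh.comp measurable_prodMk_left) fun u v => ?_
  exact H (x, u) (y, v)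

theorem pl_transfer {E F : Type} [AddCommGroup E] [Module ℝ E] [MeasureSpace E]
    [AddCommGroup F] [Module ℝ F] [MeasureSpace F] (hE : PLProp E) (e : E → F)
    (he : MeasurePreserving e volume volume) (hadd : ∀ (s t : ℝ) (x y : E), e (s • x + t • y) = s • e x + t • e y) : PLProp F := by
  intro s t hs ht hst f g h hf hg hh H
  rw [← he.lintegral_comp hf, ← he.lintegral_comp hg, ← he.lintegral_comp hh]
  refine hE s t hs ht hst _ _ _ (hf.comp he.measurable) (hg.comp he.measurable)
    (hh.comp he.measurable) fun u v => ?_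
  simp only [hadd]
  exact H _ _

theorem pl_pi (m : ℕ) : PLProp (Fin m → ℝ) := by
  induction m with
  | zero =>
    intro s t hs ht hst f g h hf hg hh H
    have : ∀ k : (Fin 0 → ℝ) → ℝ≥0∞, ∫⁻ x, k x = k 0 := by
      intro k
      rw [volume_pi, Measure.pi_of_empty _ 0, lintegral_dirac]
    rw [this, this, this]
    have := H 0 0
    simpa using this
  | succ m ih =>
    refine pl_transfer (pl_prod ih) _ (volume_preserving_piFinSuccAbove (fun _ => ℝ) 0).symm ?_
    intro s t x y
    ext i
    refine Fin.cases ?_ (fun j => ?_) i <;> simp [MeasurableEquiv.piFinSuccAbove]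

theorem pl_euclidean (m : ℕ) : PLProp (EuclideanSpace ℝ (Fin m)) := by
  refine pl_transfer (pl_pi m) _ (EuclideanSpace.volume_preserving_symm_measurableEquiv_toLp (Fin m)).symm ?_
  intro s t x y
  ext i
  simp

/-- Multiplicative Brunn-Minkowski. -/
theorem bm_mul {m : ℕ} {A B C : Set (EuclideanSpace ℝ (Fin m))} (hA : MeasurableSet A)
    (hB : MeasurableSet B) (hC : MeasurableSet C) {s t : ℝ} (hs : 0 < s) (ht : 0 < t)
    (hst : s + t = 1) (h : ∀ x ∈ A, ∀ y ∈ B, s • x + t • y ∈ C) :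
    volume A ^ s * volume B ^ t ≤ volume C := by
  have := pl_euclidean m s t hs ht hst (A.indicator 1) (B.indicator 1) (C.indicator 1)
    (measurable_one.indicator hA) (measurable_one.indicator hB) (measurable_one.indicator hC) (by
      intro x y
      by_cases hx : x ∈ A
      · by_cases hy : y ∈ B
        · simp [hx, hy, h x hx y hy]
        · simp [hy, ENNReal.zero_rpow_of_pos ht]
      · simp [hx, ENNReal.zero_rpow_of_pos hs])
  rwa [lintegral_indicator_one hA, lintegral_indicator_one hB, lintegral_indicator_one hC] at this

theorem bm_add_aux {m : ℕ} {A B C : Set (EuclideanSpace ℝ (Fin m))}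
    (hB0 : B.Nonempty) {s t : ℝ} (hs : 0 < s)
    (h : ∀ x ∈ A, ∀ y ∈ B, s • x + t • y ∈ C) {α : ℝ}
    (hα0 : 0 ≤ α) (hα : volume A = ENNReal.ofReal (α ^ m)) :
    ENNReal.ofReal ((s * α) ^ m) ≤ volume C := by
  obtain ⟨y, hy⟩ := hB0
  have h1 : volume ((fun x => x + t • y) '' (s • A)) = volume (s • A) := by
    rw [Set.image_add_right]; exact measure_preimage_add_right volume _ _
  have h2 : (fun x => x + t • y) '' (s • A) ⊆ C := by
    rintro _ ⟨_, ⟨x, hx, rfl⟩, rfl⟩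
    exact h x hx y hy
  calc ENNReal.ofReal ((s * α) ^ m) = volume (s • A) := by
        rw [Measure.addHaar_smul, hα, finrank_euclideanSpace_fin, abs_of_pos (pow_pos hs m),
          ← ENNReal.ofReal_mul (pow_pos hs m).le, mul_pow]
    _ ≤ volume C := by rw [← h1]; exact measure_mono h2

theorem bm_vol_inv_smul {m : ℕ} {A : Set (EuclideanSpace ℝ (Fin m))} {α : ℝ}
    (hα0 : 0 < α) (hα : volume A = ENNReal.ofReal (α ^ m)) : volume (α⁻¹ • A) = 1 := by
  rw [Measure.addHaar_smul, hα, finrank_euclideanSpace_fin, abs_of_pos (by positivity),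
    ← ENNReal.ofReal_mul (by positivity), ← mul_pow, inv_mul_cancel₀ hα0.ne']
  simp

theorem bm_add {m : ℕ} {A B C : Set (EuclideanSpace ℝ (Fin m))} (hA : MeasurableSet A)
    (hB : MeasurableSet B) (hC : MeasurableSet C) (hA0 : A.Nonempty) (hB0 : B.Nonempty)
    {s t : ℝ} (hs : 0 < s) (ht : 0 < t)
    (h : ∀ x ∈ A, ∀ y ∈ B, s • x + t • y ∈ C) {α β : ℝ}
    (hα0 : 0 ≤ α) (hα : volume A = ENNReal.ofReal (α ^ m))
    (hβ0 : 0 ≤ β) (hβ : volume B = ENNReal.ofReal (β ^ m)) :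
    ENNReal.ofReal ((s * α + t * β) ^ m) ≤ volume C := by
  rcases hα0.eq_or_lt with h0 | hα1
  · rw [← h0, mul_zero, zero_add]
    exact bm_add_aux (A := B) (B := A) (t := s) hA0 ht
      (fun x hx y hy => by rw [add_comm]; exact h y hy x hx) hβ0 hβ
  rcases hβ0.eq_or_lt with h0 | hβ1
  · rw [← h0, mul_zero, add_zero]
    exact bm_add_aux hB0 hs h hα0 hα
  set σ := s * α + t * β with hσ
  have hσ0 : 0 < σ := by positivity
  have key := bm_mul (A := α⁻¹ • A) (B := β⁻¹ • B) (C := σ⁻¹ • C) (hA.const_smul₀ _)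
    (hB.const_smul₀ _) (hC.const_smul₀ _) (s := s * α / σ) (t := t * β / σ) (by positivity)
    (by positivity) (by rw [← add_div, ← hσ, div_self hσ0.ne']) (by
      rintro _ ⟨x, hx, rfl⟩ _ ⟨y, hy, rfl⟩
      refine ⟨s • x + t • y, h x hx y hy, ?_⟩
      simp only [smul_add, smul_smul]
      congr 2
      · field_simp
      · field_simp)
  rw [bm_vol_inv_smul hα1 hα, bm_vol_inv_smul hβ1 hβ, Measure.addHaar_smul,
    finrank_euclideanSpace_fin, abs_of_pos (by positivity)] at key
  simp only [ENNReal.one_rpow, one_mul] at key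
  calc ENNReal.ofReal (σ ^ m) = ENNReal.ofReal (σ ^ m) * 1 := by simp
    _ ≤ ENNReal.ofReal (σ ^ m) * (ENNReal.ofReal (σ⁻¹ ^ m) * volume C) := by gcongr
    _ = volume C := by
      rw [← mul_assoc, ← ENNReal.ofReal_mul (by positivity), ← mul_pow, mul_inv_cancel₀ hσ0.ne']
      simp

theorem brunn_concave {m : ℕ} (hm : m ≠ 0) {K : Set (ℝ × EuclideanSpace ℝ (Fin m))}
    (hK : IsCompact K) (hKc : Convex ℝ K) :
    ConcaveOn ℝ (Prod.fst '' K)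
      (fun x : ℝ => (volume {y : EuclideanSpace ℝ (Fin m) | (x, y) ∈ K}).toReal ^ ((m : ℝ)⁻¹)) := by
  have hcomp : ∀ x : ℝ, IsCompact {y : EuclideanSpace ℝ (Fin m) | (x, y) ∈ K} := by
    intro x
    have hc : IsClosed {y : EuclideanSpace ℝ (Fin m) | (x, y) ∈ K} :=
      hK.isClosed.preimage (by fun_prop : Continuous fun y : EuclideanSpace ℝ (Fin m) => (x, y))
    refine (hK.image continuous_snd).of_isClosed_subset hc ?_
    intro y hy
    exact ⟨(x, y), hy, rfl⟩
  have hval : ∀ x : ℝ, volume {y : EuclideanSpace ℝ (Fin m) | (x, y) ∈ K} = ENNReal.ofReal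
      (((volume {y : EuclideanSpace ℝ (Fin m) | (x, y) ∈ K}).toReal ^ ((m : ℝ)⁻¹)) ^ m) := by
    intro x
    rw [Real.rpow_inv_natCast_pow ENNReal.toReal_nonneg hm,
      ENNReal.ofReal_toReal (hcomp x).measure_lt_top.ne]
  refine ⟨hKc.linear_image (LinearMap.fst ℝ ℝ _), ?_⟩
  rintro x hx y hy s t hs ht hst
  rcases hs.eq_or_lt with rfl | hs
  · obtain rfl : t = 1 := by linarith
    simp
  rcases ht.eq_or_lt with rfl | ht
  · obtain rfl : s = 1 := by linarith
    simp
  have hne : ∀ x ∈ Prod.fst '' K, {y : EuclideanSpace ℝ (Fin m) | (x, y) ∈ K}.Nonempty := by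
    rintro _ ⟨⟨x, y⟩, h, rfl⟩
    exact ⟨y, h⟩
  have key := bm_add (hcomp x).isClosed.measurableSet (hcomp y).isClosed.measurableSet
    (hcomp (s • x + t • y)).isClosed.measurableSet (hne x hx) (hne y hy) hs ht
    (fun u hu v hv => hKc hu hv hs.le ht.le hst) (by positivity) (hval x) (by positivity) (hval y)
  rw [hval (s • x + t • y), ENNReal.ofReal_le_ofReal_iff (by positivity)] at key
  exact le_of_pow_le_pow_left₀ hm (by positivity) key

/-- The one-dimensional data: `φ` is the `m`-th root of the section function. -/
structure Prof (m : ℕ) (I : Set ℝ) (φ : ℝ → ℝ) (R : ℝ) : Prop where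
  hm : 1 ≤ m
  meas : Measurable φ
  nonneg : ∀ x, 0 ≤ φ x
  le_one : ∀ x, φ x ≤ 1
  off : ∀ x, x ∉ I → φ x = 0
  conc : ConcaveOn ℝ I φ
  bdd : I ⊆ Icc (-R) R
  top : ∃ z, φ z = 1
  int_one : ∫ x, φ x ^ m = 1
  int_zero : ∫ x, x * φ x ^ m = 0

namespace Prof

variable {m : ℕ} {I : Set ℝ} {φ : ℝ → ℝ} {R : ℝ}

theorem mem (h : Prof m I φ R) {x : ℝ} (hx : φ x ≠ 0) : x ∈ I := by
  by_contra hx'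
  exact hx (h.off x hx')

theorem integrable_pow (h : Prof m I φ R) {k : ℕ} (hk : k ≠ 0) :
    Integrable (fun x => φ x ^ k) := by
  have h1 : Integrable (indicator (Icc (-R) R) (fun _ : ℝ => (1:ℝ))) :=
    (integrable_indicator_iff measurableSet_Icc).2 (by simp)
  refine h1.mono' (h.meas.pow_const k).aestronglyMeasurable (Filter.Eventually.of_forall fun x => ?_)
  by_cases hx : x ∈ I
  · rw [indicator_of_mem (h.bdd hx), Real.norm_of_nonneg (pow_nonneg (h.nonneg x) k)]
    exact pow_le_one₀ (h.nonneg x) (h.le_one x)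
  · rw [h.off x hx, zero_pow hk, norm_zero]
    exact indicator_nonneg (fun _ _ => zero_le_one) x

theorem integrable_mul_pow (h : Prof m I φ R) {k : ℕ} (hk : k ≠ 0) :
    Integrable (fun x => x * φ x ^ k) := by
  have h1 : Integrable (indicator (Icc (-R) R) (fun _ : ℝ => R)) :=
    (integrable_indicator_iff measurableSet_Icc).2 (by simp)
  refine h1.mono' (measurable_id.mul (h.meas.pow_const k)).aestronglyMeasurable
    (Filter.Eventually.of_forall fun x => ?_)
  by_cases hx : x ∈ I
  · rw [indicator_of_mem (h.bdd hx), norm_mul, Real.norm_of_nonneg (pow_nonneg (h.nonneg x) k)]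
    have h2 : ‖x‖ ≤ R := abs_le.2 (h.bdd hx)
    have h3 := pow_le_one₀ (n := k) (h.nonneg x) (h.le_one x)
    have h4 := pow_nonneg (h.nonneg x) k
    nlinarith [norm_nonneg x]
  · rw [h.off x hx, zero_pow hk, mul_zero, norm_zero]
    by_cases h2 : x ∈ Icc (-R) R
    · rw [indicator_of_mem h2]; linarith [h2.1, h2.2]
    · rw [indicator_of_notMem h2]

theorem m_ne (h : Prof m I φ R) : m ≠ 0 := by have := h.hm; omega

theorem exists_pos_aux (h : Prof m I φ R) (ε : ℝ) (hε : ε ≠ 0) :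
    ∃ x, 0 < ε * x ∧ x ∈ I := by
  by_contra hcon
  push Not at hcon
  have h0 : ∫ x, -(ε * x) * φ x ^ m = 0 := by
    have : ∀ x, -(ε * x) * φ x ^ m = (-ε) * (x * φ x ^ m) := fun x => by ring
    simp only [this]
    rw [integral_const_mul, h.int_zero, mul_zero]
  have hi : Integrable (fun x => -(ε * x) * φ x ^ m) := by
    have : (fun x => -(ε * x) * φ x ^ m) = fun x => (-ε) * (x * φ x ^ m) := by
      ext x; ring
    rw [this]; exact (h.integrable_mul_pow h.m_ne).const_mul _
  have hnn : 0 ≤ fun x => -(ε * x) * φ x ^ m := by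
    intro x
    show 0 ≤ -(ε * x) * φ x ^ m
    rcases le_or_gt (ε * x) 0 with hx | hx
    · exact mul_nonneg (by linarith) (pow_nonneg (h.nonneg x) m)
    · rw [h.off x (hcon x hx), zero_pow h.m_ne, mul_zero]
  have hz := (integral_eq_zero_iff_of_nonneg hnn hi).1 h0
  have hne : ∀ᵐ x : ℝ, x ≠ 0 := by
    rw [ae_iff]; simp
  have : ∫ x, φ x ^ m = 0 := by
    apply integral_eq_zero_of_ae
    filter_upwards [hz, hne] with x hx hx0
    have hx' : -(ε * x) * φ x ^ m = 0 := hx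
    rcases mul_eq_zero.1 hx' with h' | h'
    · simp [hε, hx0] at h'
    · exact h'
  rw [h.int_one] at this
  exact one_ne_zero this

theorem exists_right (h : Prof m I φ R) : ∃ x ∈ I, 0 < x := by
  obtain ⟨x, hx, hI⟩ := h.exists_pos_aux 1 one_ne_zero
  exact ⟨x, hI, by linarith⟩

theorem exists_left (h : Prof m I φ R) : ∃ x ∈ I, x < 0 := by
  obtain ⟨x, hx, hI⟩ := h.exists_pos_aux (-1) (by norm_num)
  exact ⟨x, hI, by linarith⟩

theorem conc_le (h : Prof m I φ R) {x y : ℝ} (hx : x ∈ I) (hy : y ∈ I) (a c : ℝ) (ha : 0 ≤ a)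
    (hc : 0 ≤ c) (hac : a + c = 1) : a * φ x + c * φ y ≤ φ (a * x + c * y) :=
  h.conc.2 hx hy ha hc hac

/-- Concavity through `0`: three point inequality. -/
theorem three (h : Prof m I φ R) {x y : ℝ} (hx : x ∈ I) (hy : y ∈ I) (hx0 : x < 0) (hy0 : 0 < y) :
    y * φ x + (-x) * φ y ≤ (y - x) * φ 0 := by
  have hd : 0 < y - x := by linarith
  have := h.conc_le hx hy (y / (y - x)) ((-x) / (y - x)) (by positivity)
    (div_nonneg (by linarith) hd.le) (by field_simp; ring)
  have e : (y / (y - x)) * x + ((-x) / (y - x)) * y = 0 := by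
    field_simp; ring
  rw [e] at this
  have h2 := mul_le_mul_of_nonneg_left this hd.le
  calc _ = (y - x) * (y / (y - x) * φ x + -x / (y - x) * φ y) := by field_simp
    _ ≤ _ := h2

theorem support_line (h : Prof m I φ R) : ∃ k : ℝ, ∀ x ∈ I, φ x ≤ φ 0 + k * x := by
  obtain ⟨xr, hxr, hxr0⟩ := h.exists_right
  obtain ⟨xl, hxl, hxl0⟩ := h.exists_left
  obtain ⟨k, hk1, hk2⟩ := exists_between_of_forall_le
    (s := (fun y => (φ y - φ 0) / y) '' (I ∩ Ioi 0))
    (t := (fun x => (φ x - φ 0) / x) '' (I ∩ Iio 0)) ⟨_, xr, ⟨hxr, hxr0⟩, rfl⟩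
    ⟨_, xl, ⟨hxl, hxl0⟩, rfl⟩ (by
      rintro _ ⟨y, ⟨hy, hy0⟩, rfl⟩ _ ⟨x, ⟨hx, hx0⟩, rfl⟩
      have hx0' : x < 0 := hx0
      have hy0' : 0 < y := hy0
      have := h.three hx hy hx0 hy0
      show (φ y - φ 0) / y ≤ (φ x - φ 0) / x
      rw [div_le_iff₀ hy0', div_mul_eq_mul_div, le_div_iff_of_neg hx0']
      nlinarith)
  refine ⟨k, fun x hx => ?_⟩
  rcases lt_trichotomy x 0 with h0 | h0 | h0
  · have := hk2 ⟨x, ⟨hx, h0⟩, rfl⟩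
    have h3 : k ≤ (φ x - φ 0) / x := this
    rw [le_div_iff_of_neg h0] at h3
    linarith
  · subst h0; simp
  · have := hk1 ⟨x, ⟨hx, h0⟩, rfl⟩
    have h3 : (φ x - φ 0) / x ≤ k := this
    rw [div_le_iff₀ h0] at h3
    linarith

theorem jensen (h : Prof m I φ R) : ∫ x, φ x ^ (m + 1) ≤ φ 0 := by
  obtain ⟨k, hk⟩ := h.support_line
  have h1 : ∫ x, φ x ^ (m + 1) ≤ ∫ x, (φ 0 * φ x ^ m + k * (x * φ x ^ m)) := by
    refine integral_mono (h.integrable_pow (by omega))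
      (((h.integrable_pow h.m_ne).const_mul _).add ((h.integrable_mul_pow h.m_ne).const_mul _)) ?_
    intro x
    show φ x ^ (m + 1) ≤ φ 0 * φ x ^ m + k * (x * φ x ^ m)
    by_cases hx : x ∈ I
    · have := mul_le_mul_of_nonneg_right (hk x hx) (pow_nonneg (h.nonneg x) m)
      rw [pow_succ]; linarith
    · rw [h.off x hx]; simp [h.m_ne]
  rw [integral_add ((h.integrable_pow h.m_ne).const_mul _)
    ((h.integrable_mul_pow h.m_ne).const_mul _), integral_const_mul, integral_const_mul,
    h.int_one, h.int_zero] at h1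
  linarith

theorem amgm_pow {m : ℕ} {u : ℝ} (hu : 0 ≤ u) :
    u ^ m ≤ ((m:ℝ) / (m + 1) * u + 1 / (m + 1)) ^ (m + 1) := by
  have hm : (0:ℝ) < m + 1 := by positivity
  have := Real.geom_mean_le_arith_mean2_weighted (w₁ := (m:ℝ) / (m + 1)) (w₂ := 1 / (m + 1))
    (p₁ := u) (p₂ := 1) (by positivity) (by positivity) hu zero_le_one (by field_simp)
  rw [Real.one_rpow, mul_one, mul_one] at this
  calc u ^ m = (u ^ ((m:ℝ) / (m + 1))) ^ (m + 1) := by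
        rw [← Real.rpow_natCast (u ^ ((m:ℝ) / (m + 1))), ← Real.rpow_mul hu, ← Real.rpow_natCast u]
        congr 1
        push_cast
        field_simp
    _ ≤ _ := pow_le_pow_left₀ (by positivity) this _

theorem zero_lower (h : Prof m I φ R) : (m:ℝ) / (m + 1) ≤ φ 0 := by
  obtain ⟨z, hz⟩ := h.top
  have hzI : z ∈ I := h.mem (by rw [hz]; exact one_ne_zero)
  have hm0 : (0:ℝ) < m := by exact_mod_cast h.hm
  set t : ℝ := (m:ℝ) / (m + 1) with ht
  have ht0 : 0 < t := by positivity
  set c : ℝ := 1 / (m + 1) * z with hc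
  have hFi : Integrable (fun x => φ (x + c) ^ (m + 1)) :=
    (h.integrable_pow (k := m + 1) (by omega)).comp_add_right c
  have h1 : ∫ x, φ x ^ m ≤ ∫ x, φ (t * x + c) ^ (m + 1) := by
    refine integral_mono (h.integrable_pow h.m_ne) (hFi.comp_mul_left' ht0.ne') fun x => ?_
    show φ x ^ m ≤ φ (t * x + c) ^ (m + 1)
    by_cases hx : x ∈ I
    · have h3 := h.conc_le hx hzI t (1 / (m + 1)) ht0.le (by positivity)
        (by rw [ht]; field_simp)
      rw [hz, mul_one] at h3
      exact (amgm_pow (h.nonneg x)).trans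
        (pow_le_pow_left₀ (by have := h.nonneg x; positivity) h3 _)
    · rw [h.off x hx, zero_pow h.m_ne]
      exact pow_nonneg (h.nonneg _) _
  rw [h.int_one, Measure.integral_comp_mul_left (fun x => φ (x + c) ^ (m + 1)) t,
    integral_add_right_eq_self (fun x => φ x ^ (m + 1)) c, abs_of_pos (inv_pos.2 ht0),
    smul_eq_mul] at h1
  refine le_trans ?_ h.jensen
  have := mul_le_mul_of_nonneg_left h1 ht0.le
  rwa [mul_one, mul_inv_cancel_left₀ ht0.ne'] at this

theorem zero_pow_lower (h : Prof m I φ R) : 1 / 4 ≤ φ 0 ^ m := by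
  have hm0 : (0:ℝ) < m := by exact_mod_cast h.hm
  have h1 : ((m + 1 : ℝ) / m) ^ m ≤ 4 := by
    calc ((m + 1 : ℝ) / m) ^ m ≤ (Real.exp (1 / m)) ^ m := by
          refine pow_le_pow_left₀ (by positivity) ?_ m
          have := Real.add_one_le_exp (1 / (m:ℝ))
          calc ((m + 1 : ℝ) / m) = 1 / m + 1 := by field_simp; ring
            _ ≤ _ := this
      _ = Real.exp 1 := by rw [← Real.exp_nat_mul]; congr 1; field_simp
      _ ≤ 4 := by linarith [Real.exp_one_lt_d9]
  calc (1:ℝ) / 4 ≤ 1 / ((m + 1 : ℝ) / m) ^ m := one_div_le_one_div_of_le (by positivity) h1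
    _ = ((m:ℝ) / (m + 1)) ^ m := by rw [← one_div_pow, one_div_div]
    _ ≤ _ := pow_le_pow_left₀ (by positivity) h.zero_lower m

theorem cone_int (m : ℕ) (κ b u : ℝ) :
    ∫ x in u..b, κ * (b - x) ^ m = κ * (b - u) ^ (m + 1) / (m + 1) := by
  rw [intervalIntegral.integral_const_mul,
    intervalIntegral.integral_comp_sub_left (fun x => x ^ m) b, integral_pow]
  simp
  ring

theorem cone_int_mul (m : ℕ) (κ b u c : ℝ) :
    ∫ x in u..b, (x - c) * (κ * (b - x) ^ m)
      = (b - c) * (κ * (b - u) ^ (m + 1) / (m + 1)) - κ * (b - u) ^ (m + 2) / (m + 2) := by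
  have : ∀ x, (x - c) * (κ * (b - x) ^ m) = (b - c) * (κ * (b - x) ^ m) - κ * (b - x) ^ (m + 1) := by
    intro x; ring
  simp only [this]
  rw [intervalIntegral.integral_sub (Continuous.intervalIntegrable (by fun_prop) _ _)
    (Continuous.intervalIntegrable (by fun_prop) _ _), intervalIntegral.integral_const_mul,
    cone_int, cone_int]
  push_cast
  ring

end Prof

namespace Prof

variable {m : ℕ} {I : Set ℝ} {φ : ℝ → ℝ} {R : ℝ}

theorem crossing (h : Prof m I φ R) (hp : 0 < φ 0) {b b' : ℝ} (hb : ∀ x ∈ I, x ≤ b)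
    (hb0 : 0 < b) (hbb : b < b')
    (hbal : b' * φ 0 ^ m = (m + 1) * ∫ x in (0:ℝ)..b', φ x ^ m) :
    (∀ x, x < 0 → φ x ^ m ≤ (φ 0 / b') ^ m * (b' - x) ^ m) ∧
    ∃ x0 ≤ b, ∀ x, 0 < x → x < b' →
      0 ≤ (x - x0) * ((φ 0 / b') ^ m * (b' - x) ^ m - φ x ^ m) := by
  have hb'0 : 0 < b' := hb0.trans hbb
  have h0I : (0:ℝ) ∈ I := h.mem hp.ne'
  have hκ : 0 < φ 0 / b' := by positivity
  -- a point where the profile is above the line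
  obtain ⟨s, hsI, hs0, hsb, hs⟩ : ∃ s ∈ I, 0 < s ∧ s < b' ∧ φ 0 / b' * (b' - s) ≤ φ s := by
    have hIntg : IntegrableOn (fun x => φ x ^ m - (φ 0 / b') ^ m * (b' - x) ^ m) (Ioo 0 b') := by
      refine (h.integrable_pow h.m_ne).integrableOn.sub ?_
      exact (Continuous.integrableOn_Icc (by fun_prop)).mono_set Ioo_subset_Icc_self
    obtain ⟨s, hs, hs2⟩ := exists_setAverage_le (μ := volume) (s := Ioo 0 b')
      (by simpa using hb'0) (by simp) hIntg
    have hz : ∫ x in Ioo 0 b', (φ x ^ m - (φ 0 / b') ^ m * (b' - x) ^ m) = 0 := by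
      rw [← integral_Ioc_eq_integral_Ioo, ← intervalIntegral.integral_of_le hb'0.le,
        intervalIntegral.integral_sub (h.integrable_pow h.m_ne).intervalIntegrable
          (Continuous.intervalIntegrable (by fun_prop) _ _), cone_int]
      have : (∫ x in (0:ℝ)..b', φ x ^ m) = b' * φ 0 ^ m / (m + 1) := by
        rw [hbal]; field_simp
      rw [this, div_pow, sub_zero, pow_succ]
      field_simp
      ring
    rw [setAverage_eq, hz, smul_zero] at hs2
    have h1 : (φ 0 / b' * (b' - s)) ^ m ≤ φ s ^ m := by rw [mul_pow]; linarith
    have h2 := le_of_pow_le_pow_left₀ h.m_ne (h.nonneg s) h1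
    have h3 : 0 < φ 0 / b' * (b' - s) := mul_pos hκ (by linarith [hs.2])
    exact ⟨s, h.mem (by linarith), hs.1, hs.2, h2⟩
  refine ⟨fun x hx => ?_, ?_⟩
  · rw [← mul_pow]
    refine pow_le_pow_left₀ (h.nonneg x) ?_ m
    by_cases hxI : x ∈ I
    · have h3 := h.three hxI hsI hx hs0
      have h4 : s * φ x ≤ s * (φ 0 / b' * (b' - x)) := by
        have h5 := mul_le_mul_of_nonneg_left hs (by linarith : 0 ≤ -x)
        have h6 : φ 0 / b' * b' = φ 0 := by field_simp
        nlinarith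
      exact le_of_mul_le_mul_left h4 hs0
    · rw [h.off x hxI]
      exact mul_nonneg hκ.le (by linarith)
  · set S : Set ℝ := {x | x ∈ I ∧ 0 < x ∧ φ 0 / b' * (b' - x) ≤ φ x} with hS
    have hsS : s ∈ S := ⟨hsI, hs0, hs⟩
    have hSb : BddAbove S := ⟨b, fun x hx => hb x hx.1⟩
    refine ⟨sSup S, csSup_le ⟨s, hsS⟩ fun x hx => hb x hx.1, fun x hx0 hxb => ?_⟩
    rw [← mul_pow]
    have hl0 : 0 ≤ φ 0 / b' * (b' - x) := mul_nonneg hκ.le (by linarith)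
    rcases lt_trichotomy x (sSup S) with hx | hx | hx
    · obtain ⟨w, ⟨hwI, hw0, hw⟩, hxw⟩ := exists_lt_of_lt_csSup ⟨s, hsS⟩ hx
      refine mul_nonneg_of_nonpos_of_nonpos (by linarith) ?_
      rw [sub_nonpos]
      refine pow_le_pow_left₀ hl0 ?_ m
      have h3 := h.conc_le h0I hwI ((w - x) / w) (x / w) (div_nonneg (by linarith) hw0.le)
        (by positivity) (by field_simp; ring)
      have e : (w - x) / w * 0 + x / w * w = x := by field_simp; ring
      rw [e] at h3
      refine le_trans ?_ h3
      have h5 := mul_le_mul_of_nonneg_left hw (by positivity : 0 ≤ x / w)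
      calc φ 0 / b' * (b' - x) = (w - x) / w * φ 0 + x / w * (φ 0 / b' * (b' - w)) := by
            field_simp; ring
        _ ≤ _ := by linarith
    · rw [hx]; simp
    · refine mul_nonneg (by linarith) ?_
      rw [sub_nonneg]
      refine pow_le_pow_left₀ (h.nonneg x) ?_ m
      by_cases hxI : x ∈ I
      · by_contra hcon
        push Not at hcon
        exact absurd (le_csSup hSb ⟨hxI, hx0, hcon.le⟩) (by linarith)
      · rw [h.off x hxI]; exact hl0

theorem moment (h : Prof m I φ R) (hp : 0 < φ 0) {b b' v : ℝ} (hb : ∀ x ∈ I, x ≤ b)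
    (hb0 : 0 < b) (hbb : b < b') (hv0 : 0 < v) (hv1 : v ≤ 1)
    (hV : ∫ x in (0:ℝ)..b', φ x ^ m = v ^ (m + 1))
    (hbal : b' * φ 0 ^ m = (m + 1) * v ^ (m + 1)) :
    (φ 0 / b') ^ m * (b' - b) ^ (m + 2) / ((m + 1) * (m + 2)) ≤
      b' - b' / v * (m + 1) / (m + 2) := by
  have hb'0 : 0 < b' := hb0.trans hbb
  obtain ⟨hleft, x0, hx0b, hright⟩ := h.crossing hp hb hb0 hbb (by rw [hV]; exact hbal)
  set κ := (φ 0 / b') ^ m with hκ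
  have hκ0 : 0 < κ := by positivity
  have hκv : κ * b' ^ (m + 1) / (m + 1) = v ^ (m + 1) := by
    have : κ * b' ^ (m + 1) = b' * φ 0 ^ m := by
      rw [hκ, div_pow, pow_succ]; field_simp
    rw [this, hbal]; field_simp
  set L := b' / v with hL
  have hL0 : 0 < L := by positivity
  have hLb : b' ≤ L := by rw [hL, le_div_iff₀ hv0]; nlinarith
  have hκL : κ * L ^ (m + 1) / (m + 1) = 1 := by
    have : κ * L ^ (m + 1) / (m + 1) = (κ * b' ^ (m + 1) / (m + 1)) / v ^ (m + 1) := by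
      rw [hL, div_pow]; field_simp
    rw [this, hκv, div_self (by positivity)]
  set r := L - b' with hr
  have hr0 : 0 ≤ r := by linarith
  set M := max R r + 1 with hM
  have hMR : R < M := by have := le_max_left R r; linarith
  have hMr : r < M := by have := le_max_right R r; linarith
  have hsupp : ∀ x, φ x ≠ 0 → x ∈ Ioc (-M) b' := fun x hx =>
    ⟨by linarith [(h.bdd (h.mem hx)).1], by linarith [hb x (h.mem hx)]⟩
  have hfi : ∀ u w : ℝ, IntervalIntegrable (fun x => φ x ^ m) volume u w := fun u w =>
    (h.integrable_pow h.m_ne).intervalIntegrable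
  have hxfi : ∀ u w : ℝ, IntervalIntegrable (fun x => x * φ x ^ m) volume u w := fun u w =>
    (h.integrable_mul_pow h.m_ne).intervalIntegrable
  have hcfi : ∀ c u w : ℝ, IntervalIntegrable (fun x => (x - c) * φ x ^ m) volume u w := by
    intro c u w
    have : (fun x => (x - c) * φ x ^ m) = fun x => x * φ x ^ m - c * φ x ^ m := by ext x; ring
    rw [this]; exact (hxfi u w).sub ((hfi u w).const_mul c)
  have hcf : ∀ c u w : ℝ, ∫ x in u..w, (x - c) * φ x ^ m
      = (∫ x in u..w, x * φ x ^ m) - c * ∫ x in u..w, φ x ^ m := by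
    intro c u w
    rw [← intervalIntegral.integral_const_mul, ← intervalIntegral.integral_sub (hxfi u w)
      ((hfi u w).const_mul c)]
    congr 1; ext x; ring
  have hgi : ∀ c u w : ℝ, IntervalIntegrable (fun x => (x - c) * (κ * (b' - x) ^ m)) volume u w :=
    fun c u w => Continuous.intervalIntegrable (by fun_prop) _ _
  have tot1 : (∫ x in (-M)..0, φ x ^ m) + ∫ x in (0:ℝ)..b', φ x ^ m = 1 := by
    rw [intervalIntegral.integral_add_adjacent_intervals (hfi _ _) (hfi _ _),
      intervalIntegral.integral_eq_integral_of_support_subset, h.int_one]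
    intro x hx
    exact hsupp x fun h0 => hx (by simp [h0, h.m_ne])
  have tot2 : (∫ x in (-M)..0, x * φ x ^ m) + ∫ x in (0:ℝ)..b', x * φ x ^ m = 0 := by
    rw [intervalIntegral.integral_add_adjacent_intervals (hxfi _ _) (hxfi _ _),
      intervalIntegral.integral_eq_integral_of_support_subset, h.int_zero]
    intro x hx
    exact hsupp x fun h0 => hx (by simp [h0, h.m_ne])
  -- left part
  have left1 : ∫ x in (-M)..(-r), (x - (-r)) * φ x ^ m ≤ 0 := by
    have : ∫ x in (-M)..(-r), (x - (-r)) * φ x ^ m ≤ ∫ x in (-M)..(-r), (0:ℝ) := by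
      refine intervalIntegral.integral_mono_on (by linarith) (hcfi _ _ _) (by simp) fun x hx => ?_
      exact mul_nonpos_of_nonpos_of_nonneg (by linarith [hx.2]) (pow_nonneg (h.nonneg x) m)
    simpa using this
  have left2 : ∫ x in (-r)..0, (x - (-r)) * φ x ^ m ≤
      ∫ x in (-r)..0, (x - (-r)) * (κ * (b' - x) ^ m) := by
    refine intervalIntegral.integral_mono_on_of_le_Ioo (by linarith) (hcfi _ _ _) (hgi _ _ _)
      fun x hx => ?_
    exact mul_le_mul_of_nonneg_left (hleft x hx.2) (by linarith [hx.1])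
  have left3 := intervalIntegral.integral_add_adjacent_intervals (hcfi (-r) (-M) (-r))
    (hcfi (-r) (-r) 0)
  rw [hcf (-r) (-M) 0] at left3
  have left4 := intervalIntegral.integral_add_adjacent_intervals (hgi (-r) (-r) 0) (hgi (-r) 0 b')
  rw [cone_int_mul, cone_int_mul] at left4
  -- right part
  have hdi : ∀ u w : ℝ, IntervalIntegrable
      (fun x => (x - x0) * (κ * (b' - x) ^ m) - (x - x0) * φ x ^ m) volume u w :=
    fun u w => (hgi _ _ _).sub (hcfi _ _ _)
  have right1 : 0 ≤ ∫ x in (0:ℝ)..b, ((x - x0) * (κ * (b' - x) ^ m) - (x - x0) * φ x ^ m) := by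
    have : ∫ x in (0:ℝ)..b, (0:ℝ) ≤
        ∫ x in (0:ℝ)..b, ((x - x0) * (κ * (b' - x) ^ m) - (x - x0) * φ x ^ m) := by
      refine intervalIntegral.integral_mono_on_of_le_Ioo hb0.le (by simp) (hdi _ _) fun x hx => ?_
      rw [← mul_sub]
      exact hright x hx.1 (by linarith [hx.2])
    simpa using this
  have right2 : ∫ x in b..b', (x - b) * (κ * (b' - x) ^ m) ≤
      ∫ x in b..b', ((x - x0) * (κ * (b' - x) ^ m) - (x - x0) * φ x ^ m) := by
    refine intervalIntegral.integral_mono_on_of_le_Ioo hbb.le (hgi _ _ _) (hdi _ _) fun x hx => ?_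
    have hx' : φ x = 0 := h.off x fun hxI => by linarith [hb x hxI, hx.1]
    rw [hx', zero_pow h.m_ne, mul_zero, sub_zero]
    refine mul_le_mul_of_nonneg_right (by linarith) ?_
    exact mul_nonneg hκ0.le (pow_nonneg (by linarith [hx.2]) m)
  have right3 := intervalIntegral.integral_add_adjacent_intervals (hdi 0 b) (hdi b b')
  rw [intervalIntegral.integral_sub (hgi _ 0 b') (hcfi _ 0 b'), hcf x0 0 b', hV,
    cone_int_mul] at right3
  rw [cone_int_mul] at right2
  rw [hV] at tot1
  have e1 : b' - -r = L := by rw [hr]; ring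
  rw [e1, hκL] at left4
  simp only [sub_zero] at left4 right3
  rw [hκv] at left4 right3
  have e2 : κ * L ^ (m + 2) / (m + 2) = L * (m + 1) / (m + 2) := by
    have : κ * L ^ (m + 2) = (κ * L ^ (m + 1) / (m + 1)) * (L * (m + 1)) := by field_simp; ring
    rw [this, hκL, one_mul]
  rw [e2] at left4
  have e3 : (b' - b) * (κ * (b' - b) ^ (m + 1) / (m + 1)) - κ * (b' - b) ^ (m + 2) / (m + 2)
      = κ * (b' - b) ^ (m + 2) / ((m + 1) * (m + 2)) := by
    field_simp; ring
  rw [e3] at right2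
  have e4 : (∫ x in (-M)..0, φ x ^ m) = 1 - v ^ (m + 1) := by linarith
  rw [e4] at left3
  nlinarith

theorem final_bound (h : Prof m I φ R) {b b' v d : ℝ} (hb : ∀ x ∈ I, x ≤ b)
    (hv0 : 0 ≤ v) (hv1 : v ≤ 1)
    (hV : ∫ x in Ioi (0:ℝ), φ x ^ m = v ^ (m + 1))
    (hb' : b' = (m + 1) / φ 0 ^ m * v ^ (m + 1)) (hd : d = v - (m + 1) / (m + 2)) :
    b' - b ≤ 288 * ((m:ℝ) + 1) ^ 2 * d ^ ((1:ℝ) / (2 * (m + 1))) := by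
  obtain ⟨xr, hxr, hxr0⟩ := h.exists_right
  have hb0 : 0 < b := hxr0.trans_le (hb xr hxr)
  have hq := h.zero_pow_lower
  have hp : 0 < φ 0 := by
    rcases (h.nonneg 0).eq_or_lt with h0 | h0
    · rw [← h0, zero_pow h.m_ne] at hq; norm_num at hq
    · exact h0
  have hpow : (0:ℝ) < φ 0 ^ m := by positivity
  rcases le_or_gt b' b with hle | hbb
  · refine le_trans (by linarith : b' - b ≤ 0) ?_
    refine mul_nonneg (by positivity) ?_
    rcases le_or_gt 0 d with hd0 | hd0
    · exact Real.rpow_nonneg hd0 _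
    · rw [Real.rpow_def_of_neg hd0]
      refine mul_nonneg (Real.exp_pos _).le (Real.cos_nonneg_of_mem_Icc ⟨?_, ?_⟩)
      · have := Real.pi_pos
        have : 0 ≤ (1:ℝ) / (2 * (m + 1)) * Real.pi := by positivity
        linarith
      · have h1 : (1:ℝ) / (2 * (m + 1)) ≤ 1 / 2 :=
          one_div_le_one_div_of_le (by norm_num) (by linarith [Nat.cast_nonneg (α := ℝ) m])
        nlinarith [Real.pi_pos]
  have hb'0 : 0 < b' := hb0.trans hbb
  have hvpos : 0 < v := by
    rcases hv0.eq_or_lt with h0 | h0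
    · rw [← h0] at hb'; simp at hb'; linarith
    · exact h0
  have hbal : b' * φ 0 ^ m = (m + 1) * v ^ (m + 1) := by rw [hb']; field_simp
  have hV' : ∫ x in (0:ℝ)..b', φ x ^ m = v ^ (m + 1) := by
    rw [← hV, intervalIntegral.integral_of_le hb'0.le]
    symm
    refine setIntegral_eq_of_subset_of_forall_sdiff_eq_zero measurableSet_Ioi Ioc_subset_Ioi_self ?_
    rintro x ⟨hx1, hx2⟩
    have : φ x = 0 := h.off x fun hxI => hx2 ⟨hx1, by linarith [hb x hxI]⟩
    rw [this, zero_pow h.m_ne]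
  have key := h.moment hp hb hb0 hbb hvpos hv1 hV' hbal
  set δ := b' - b with hδ
  have hδ0 : 0 < δ := by linarith
  have hκ : (φ 0 / b') ^ m = (m + 1) * v ^ (m + 1) / b' ^ (m + 1) := by
    rw [← hbal, div_pow, pow_succ]; field_simp
  have hdv : b' - b' / v * (m + 1) / (m + 2) = b' / v * d := by
    rw [hd]; field_simp
  rw [hκ, hdv] at key
  have hdpos : 0 < d := by
    have h1 : 0 < (m + 1) * v ^ (m + 1) / b' ^ (m + 1) * δ ^ (m + 2) / (((m:ℝ) + 1) * (m + 2)) := by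
      positivity
    have h2 := h1.trans_le key
    exact (pos_iff_pos_of_mul_pos h2).1 (by positivity)
  have hvhalf : 1 / 2 ≤ v := by
    have : (1:ℝ) / 2 ≤ (m + 1) / (m + 2) := by
      rw [div_le_div_iff₀ (by norm_num) (by positivity)]
      linarith [Nat.cast_nonneg (α := ℝ) m]
    linarith
  have hd1 : d ≤ 1 := by
    have : (0:ℝ) ≤ (m + 1) / (m + 2) := by positivity
    linarith
  have hb4 : b' ≤ 4 * (m + 1) := by
    have h1 : v ^ (m + 1) ≤ 1 := pow_le_one₀ hv0 hv1
    nlinarith [Nat.cast_nonneg (α := ℝ) m]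
  -- rearranged
  have key2 : (v * δ) ^ (m + 2) ≤ (m + 2) * d * b' ^ (m + 2) := by
    have h1 := mul_le_mul_of_nonneg_left key
      (by positivity : 0 ≤ v * b' ^ (m + 1) * (m + 2))
    calc (v * δ) ^ (m + 2) = v * b' ^ (m + 1) * (m + 2) * ((m + 1) * v ^ (m + 1) / b' ^ (m + 1)
            * δ ^ (m + 2) / (((m:ℝ) + 1) * (m + 2))) := by field_simp; ring
      _ ≤ v * b' ^ (m + 1) * (m + 2) * (b' / v * d) := h1
      _ = _ := by field_simp; ring
  have hm2 : ((m:ℝ) + 2) ≤ 2 ^ (m + 2) := by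
    have : m + 2 < 2 ^ (m + 2) := Nat.lt_two_pow_self
    exact_mod_cast this.le
  have hn1 : (1:ℝ) ≤ (m:ℝ) + 1 := by linarith [Nat.cast_nonneg (α := ℝ) m]
  have key3 : δ ^ (m + 2) ≤ d * (288 * ((m:ℝ) + 1) ^ 2) ^ (m + 2) := by
    have h1 : (1 / 2 * δ) ^ (m + 2) ≤ (v * δ) ^ (m + 2) :=
      pow_le_pow_left₀ (by positivity) (mul_le_mul_of_nonneg_right hvhalf hδ0.le) _
    calc δ ^ (m + 2) = 2 ^ (m + 2) * (1 / 2 * δ) ^ (m + 2) := by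
          rw [← mul_pow]; congr 1; ring
      _ ≤ 2 ^ (m + 2) * ((m + 2) * d * b' ^ (m + 2)) := by
          gcongr; exact h1.trans key2
      _ ≤ 2 ^ (m + 2) * (2 ^ (m + 2) * d * (4 * (m + 1)) ^ (m + 2)) := by
          gcongr
      _ = d * (2 * 2 * (4 * (m + 1))) ^ (m + 2) := by rw [mul_pow (2 * 2 : ℝ), mul_pow (2 : ℝ) 2]; ring
      _ ≤ _ := by
          refine mul_le_mul_of_nonneg_left (pow_le_pow_left₀ (by positivity) ?_ _) hdpos.le
          nlinarith
  set e := (1:ℝ) / (2 * (m + 1)) with he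
  have hde : d ≤ (d ^ e) ^ (m + 2) := by
    rw [← Real.rpow_natCast, ← Real.rpow_mul hdpos.le]
    have : e * ((m + 2 : ℕ) : ℝ) ≤ 1 := by
      rw [he]; push_cast
      rw [div_mul_eq_mul_div, div_le_one (by positivity)]
      linarith
    calc d = d ^ (1:ℝ) := (Real.rpow_one d).symm
      _ ≤ _ := Real.rpow_le_rpow_of_exponent_ge hdpos hd1 this
  refine le_of_pow_le_pow_left₀ (n := m + 2) (by omega) (by positivity) ?_
  rw [mul_pow _ (d ^ e)]
  calc δ ^ (m + 2) ≤ d * (288 * ((m:ℝ) + 1) ^ 2) ^ (m + 2) := key3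
    _ ≤ (d ^ e) ^ (m + 2) * (288 * ((m:ℝ) + 1) ^ 2) ^ (m + 2) := by gcongr
    _ = _ := by ring

end Prof

theorem core_bound (m n : ℕ) (hm : m ≠ 0) (hnm : n = m + 1)
    (K : Set (ℝ × EuclideanSpace ℝ (Fin m)))
    (hKcomp : IsCompact K) (hKconv : Convex ℝ K)
    (hH1 : (∫ p in K, p) = 0)
    (hH3le : ∀ x : ℝ, volume {y : EuclideanSpace ℝ (Fin m) | (x, y) ∈ K} ≤ 1)
    (hH3eq : ∃ x : ℝ, volume {y : EuclideanSpace ℝ (Fin m) | (x, y) ∈ K} = 1)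
    (hH4 : volume K = 1)
    (b : ℝ) (hb : IsGreatest (Prod.fst '' K) b)
    (b' : ℝ)
    (hb' : b' = ((n:ℝ) / (volume {y : EuclideanSpace ℝ (Fin m) | ((0:ℝ), y) ∈ K}).toReal)
            * (volume (K ∩ {p : ℝ × EuclideanSpace ℝ (Fin m) | 0 ≤ p.1})).toReal)
    (d : ℝ)
    (hd : d = (volume (K ∩ {p : ℝ × EuclideanSpace ℝ (Fin m) | 0 ≤ p.1})).toReal ^ ((n:ℝ)⁻¹)
            - (((n:ℝ) / (n + 1)) ^ n) ^ ((n:ℝ)⁻¹)) :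
    b' - b ≤ 288 * (n:ℝ) ^ 2 * d ^ ((1:ℝ) / (2 * n)) := by
  have hKm : MeasurableSet K := hKcomp.isClosed.measurableSet
  set S : ℝ → ENNReal := fun x => volume {y : EuclideanSpace ℝ (Fin m) | (x, y) ∈ K} with hS
  set φ : ℝ → ℝ := fun x => (S x).toReal ^ ((m : ℝ)⁻¹) with hφ
  have hSm : Measurable S := measurable_measure_prodMk_left hKm
  have hpow : ∀ x, φ x ^ m = (S x).toReal := fun x =>
    Real.rpow_inv_natCast_pow ENNReal.toReal_nonneg hm
  have hSfin : ∀ x, S x < ⊤ := fun x => (hH3le x).trans_lt ENNReal.one_lt_top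
  have hSle : ∀ x, (S x).toReal ≤ 1 := fun x => ENNReal.toReal_le_of_le_ofReal zero_le_one
    (by simpa using hH3le x)
  have hvolK : ∫⁻ x, S x = 1 := by
    rw [← hH4, Measure.volume_eq_prod, Measure.prod_apply hKm]; rfl
  have hint1 : ∫ x, φ x ^ m = 1 := by
    simp only [hpow]
    rw [integral_toReal hSm.aemeasurable (Filter.Eventually.of_forall hSfin), hvolK]; simp
  have hHm : MeasurableSet {p : ℝ × EuclideanSpace ℝ (Fin m) | 0 ≤ p.1} :=
    measurableSet_le measurable_const measurable_fst
  have hvolH : volume (K ∩ {p : ℝ × EuclideanSpace ℝ (Fin m) | 0 ≤ p.1})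
      = ∫⁻ x in Ioi (0:ℝ), S x := by
    rw [Measure.volume_eq_prod, Measure.prod_apply (hKm.inter hHm), setLIntegral_congr Ioi_ae_eq_Ici,
      ← lintegral_indicator measurableSet_Ici]
    refine lintegral_congr fun x => ?_
    by_cases hx : 0 ≤ x
    · rw [indicator_of_mem (show x ∈ Ici (0:ℝ) from hx)]
      simp only [hS]
      congr 1
      ext y
      simp [hx]
    · rw [indicator_of_notMem (show x ∉ Ici (0:ℝ) from hx)]
      convert measure_empty (μ := (volume : Measure (EuclideanSpace ℝ (Fin m))))
      ext y
      simp [hx]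
  set V := (volume (K ∩ {p : ℝ × EuclideanSpace ℝ (Fin m) | 0 ≤ p.1})).toReal with hVdef
  have hV : ∫ x in Ioi (0:ℝ), φ x ^ m = V := by
    simp only [hpow]
    rw [integral_toReal hSm.aemeasurable (Filter.Eventually.of_forall hSfin), hVdef, hvolH]
  have hV0 : 0 ≤ V := ENNReal.toReal_nonneg
  have hV1 : V ≤ 1 := by
    refine ENNReal.toReal_le_of_le_ofReal zero_le_one ?_
    rw [ENNReal.ofReal_one, ← hH4]
    exact measure_mono inter_subset_left
  have hint0 : ∫ x, x * φ x ^ m = 0 := by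
    simp only [hpow]
    have hi : IntegrableOn (fun p : ℝ × EuclideanSpace ℝ (Fin m) => p) K :=
      continuousOn_id.integrableOn_compact hKcomp
    have h1 : ∫ p in K, p.1 = 0 := by
      have := fst_integral hi
      rw [hH1] at this
      simpa using this.symm
    have hi1 : IntegrableOn (fun p : ℝ × EuclideanSpace ℝ (Fin m) => p.1) K :=
      continuous_fst.continuousOn.integrableOn_compact hKcomp
    rw [← integral_indicator hKm] at h1
    have hi2 := (integrable_indicator_iff hKm).2 hi1
    rw [Measure.volume_eq_prod] at h1 hi2
    rw [integral_prod _ hi2] at h1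
    rw [← h1]
    congr 1
    ext x
    have hm2 : MeasurableSet {y : EuclideanSpace ℝ (Fin m) | (x, y) ∈ K} := measurable_prodMk_left hKm
    have : (fun y : EuclideanSpace ℝ (Fin m) => K.indicator (fun p => p.1) (x, y))
        = {y : EuclideanSpace ℝ (Fin m) | (x, y) ∈ K}.indicator (fun _ => x) := by
      ext y
      by_cases hy : (x, y) ∈ K
      · rw [indicator_of_mem hy, indicator_of_mem (show y ∈ {y | (x, y) ∈ K} from hy)]
      · rw [indicator_of_notMem hy, indicator_of_notMem (show y ∉ {y | (x, y) ∈ K} from hy)]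
    rw [this, integral_indicator hm2, setIntegral_const]
    simp [hS, Measure.real, mul_comm]
  obtain ⟨R, hR⟩ : ∃ R : ℝ, Prod.fst '' K ⊆ Icc (-R) R := by
    obtain ⟨R, hR⟩ := (hKcomp.image continuous_fst).isBounded.subset_closedBall (0:ℝ)
    refine ⟨R, hR.trans ?_⟩
    rw [Real.closedBall_eq_Icc]; simp
  have P : Prof m (Prod.fst '' K) φ R :=
    { hm := Nat.one_le_iff_ne_zero.2 hm
      meas := hSm.ennreal_toReal.pow_const _
      nonneg := fun x => by positivity
      le_one := fun x => Real.rpow_le_one ENNReal.toReal_nonneg (hSle x) (by positivity)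
      off := fun x hx => by
        have : {y : EuclideanSpace ℝ (Fin m) | (x, y) ∈ K} = ∅ := by
          ext y
          simp only [mem_ofPred_eq, mem_empty_iff_false, iff_false]
          exact fun hy => hx ⟨(x, y), hy, rfl⟩
        simp [hφ, hS, this, hm]
      conc := brunn_concave hm hKcomp hKconv
      bdd := hR
      top := by
        obtain ⟨z, hz⟩ := hH3eq
        refine ⟨z, ?_⟩
        have hz' : S z = 1 := hz
        simp [hφ, hz']
      int_one := hint1
      int_zero := hint0 }
  have hn0 : n ≠ 0 := by omega
  have hnR : (n:ℝ) = m + 1 := by rw [hnm]; push_cast; ring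
  have hvn : (V ^ ((n:ℝ)⁻¹)) ^ (m + 1) = V := by
    rw [← hnm]; exact Real.rpow_inv_natCast_pow hV0 hn0
  have hd' : d = V ^ ((n:ℝ)⁻¹) - (m + 1) / (m + 2) := by
    rw [hd, Real.pow_rpow_inv_natCast (by positivity) hn0, hnR]
    congr 2; ring
  have := P.final_bound (b := b) (b' := b') (v := V ^ ((n:ℝ)⁻¹)) (d := d) (fun x hx => hb.2 hx)
    (by positivity) (Real.rpow_le_one hV0 hV1 (by positivity)) (by rw [hvn, hV])
    (by rw [hvn, hpow, hb', hnR]) hd'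
  rw [hnR]
  exact this

end Helpers

theorem b_prime_minus_b_bound (n : ℕ) (hn : 2 ≤ n)
    (K : Set (ℝ × EuclideanSpace ℝ (Fin (n - 1))))
    (hKcomp : IsCompact K) (hKconv : Convex ℝ K)
    -- (H1): the centroid of K is the origin
    (hH1 : (∫ p in K, p) = 0)
    -- (H3): max_x |K_x| = 1
    (hH3le : ∀ x : ℝ, volume {y : EuclideanSpace ℝ (Fin (n - 1)) | (x, y) ∈ K} ≤ 1)
    (hH3eq : ∃ x : ℝ, volume {y : EuclideanSpace ℝ (Fin (n - 1)) | (x, y) ∈ K} = 1)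
    -- (H4): |K| = 1
    (hH4 : volume K = 1)
    (b : ℝ) (hb : IsGreatest (Prod.fst '' K) b)
    (b' : ℝ)
    (hb' : b' = ((n:ℝ) / (volume {y : EuclideanSpace ℝ (Fin (n - 1)) | ((0:ℝ), y) ∈ K}).toReal)
            * (volume (K ∩ {p : ℝ × EuclideanSpace ℝ (Fin (n - 1)) | 0 ≤ p.1})).toReal)
    (d : ℝ)
    (hd : d = (volume (K ∩ {p : ℝ × EuclideanSpace ℝ (Fin (n - 1)) | 0 ≤ p.1})).toReal ^ ((n:ℝ)⁻¹)
            - (((n:ℝ) / (n + 1)) ^ n) ^ ((n:ℝ)⁻¹)) :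
    b' - b ≤ 288 * (n:ℝ) ^ 2 * d ^ ((1:ℝ) / (2 * n)) := by
  exact core_bound (n - 1) n (by omega) (by omega) K hKcomp hKconv hH1 hH3le hH3eq hH4 b hb b' hb' d hd
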